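/- Derivation of the third (minimum) inequality of Theorem 1: Let S, T, K, W, U, V, Ŷ1, Ŷ2, Y11, Y12, Y21, Y22 be random variables with K = α∘S = β∘T almost surely for some functions α, β. Suppose there exist real numbers ρ0, ρ1, ρ2, r1, r2 with r1 ≥ 0, r2 ≥ 0, ρ0 > I[(S,T):W|K], ρ1 + ρ2 > I[(S,U):(T,V)|W] − I[S:T|W], H[S|(K,W)] ≤ I[(S,U):(Ŷ2,Y11,Y12)|(K,W)] + r1 − ρ1, H[T|(K,W)] ≤ I[(T,V):(Ŷ1,Y21,Y22)|(K,W)] + r2 − ρ2, H[S|(K,W)] + H[K] ≤ I[(S,U,W):(Ŷ2,Y11,Y12)] − r2 − ρ0 − ρ1, and H[T|(K,W)] + H[K] ≤ I[(T,V,W):(Ŷ1,Y21,Y22)] − r1 − ρ0 − ρ2. Then H[(S,T)] < min{I[(K,W):(Ŷ2,Y11,Y12)], I[(K,W):(Ŷ1,Y21,Y22)]} + I[(S,U):(Ŷ2,Y11,Y12)|(K,W)] + I[(T,V):(Ŷ1,Y21,Y22)|(K,W)] − I[(S,U):(T,V)|(K,W)]. -/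

import Mathlib

open MeasureTheory

namespace JSCC

variable {Ω : Type*} [MeasurableSpace Ω]

/-- Shannon entropy (natural log) of a finite-valued random variable. -/
noncomputable def H {A : Type*} [Fintype A] (μ : Measure Ω) (X : Ω → A) : ℝ :=
  ∑ a : A, Real.negMulLog (μ (X ⁻¹' {a})).toReal

/-- The pair of two random variables. -/
def p2 {A B : Type*} (X : Ω → A) (Y : Ω → B) : Ω → A × B := fun ω => (X ω, Y ω)

/-- The triple of three random variables. -/
def p3 {A B C : Type*} (X : Ω → A) (Y : Ω → B) (Z : Ω → C) : Ω → A × B × C :=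
  fun ω => (X ω, Y ω, Z ω)

/-- Conditional entropy `H[X|Y]`. -/
noncomputable def cH {A B : Type*} [Fintype A] [Fintype B] (μ : Measure Ω)
    (X : Ω → A) (Y : Ω → B) : ℝ :=
  H μ (p2 X Y) - H μ Y

/-- Mutual information `I[X:Y]`. -/
noncomputable def I {A B : Type*} [Fintype A] [Fintype B] (μ : Measure Ω)
    (X : Ω → A) (Y : Ω → B) : ℝ :=
  H μ X + H μ Y - H μ (p2 X Y)

/-- Conditional mutual information `I[X:Y|Z]`. -/
noncomputable def cI {A B C : Type*} [Fintype A] [Fintype B] [Fintype C] (μ : Measure Ω)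
    (X : Ω → A) (Y : Ω → B) (Z : Ω → C) : ℝ :=
  H μ (p2 X Z) + H μ (p2 Y Z) - H μ (p2 X (p2 Y Z)) - H μ Z

end JSCC

open JSCC

/-- If `Z` is almost surely fixed by `h`, then `h` fixes every value contributing to `H[Z]`. -/
lemma eq_of_ae_eq_of_negMulLog_ne_zero {Ω C : Type*} [MeasurableSpace Ω] {μ : Measure Ω}
    {Z : Ω → C} {h : C → C} (hZ : ∀ᵐ ω ∂μ, Z ω = h (Z ω)) {c : C}
    (hc : Real.negMulLog (μ (Z ⁻¹' {c})).toReal ≠ 0) : h c = c := by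
  by_contra hne
  refine hc ?_
  have h0 : μ (Z ⁻¹' {c}) = 0 := by
    refine measure_mono_null (t := {ω | ¬Z ω = h (Z ω)}) (fun ω hω hfix => hne ?_) (ae_iff.mp hZ)
    rw [Set.mem_preimage, Set.mem_singleton_iff] at hω
    rw [hω] at hfix
    exact hfix.symm
  simp [h0]

/-- Two random variables that almost surely determine each other have the same entropy. -/
lemma H_eq_of_ae_eq_comp {Ω A B : Type*} [MeasurableSpace Ω] [Fintype A] [Fintype B]
    {μ : Measure Ω} {X : Ω → A} {Y : Ω → B} (f : A → B) (g : B → A)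
    (hf : ∀ᵐ ω ∂μ, Y ω = f (X ω)) (hg : ∀ᵐ ω ∂μ, X ω = g (Y ω)) : H μ X = H μ Y := by
  have hgf : ∀ᵐ ω ∂μ, X ω = g (f (X ω)) := by
    filter_upwards [hf, hg] with ω h₁ h₂
    rw [← h₁, ← h₂]
  have hfg : ∀ᵐ ω ∂μ, Y ω = f (g (Y ω)) := by
    filter_upwards [hf, hg] with ω h₁ h₂
    rw [← h₂, ← h₁]
  have fiber {a : A} (ha : g (f a) = a) : μ (X ⁻¹' {a}) = μ (Y ⁻¹' {f a}) := by
    refine measure_congr ?_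
    filter_upwards [hf, hg] with ω h₁ h₂
    refine propext ⟨fun h => ?_, fun h => ?_⟩
    · exact h₁.trans (congrArg f h)
    · exact h₂.trans ((congrArg g h).trans ha)
  have hgf' {a : A} (ha : Real.negMulLog (μ (X ⁻¹' {a})).toReal ≠ 0) : g (f a) = a :=
    eq_of_ae_eq_of_negMulLog_ne_zero (h := g ∘ f) hgf ha
  refine Finset.sum_bij_ne_zero (fun a _ _ => f a) (fun _ _ _ => Finset.mem_univ _) ?_ ?_ ?_
  · intro a _ ha b _ hb hab
    rw [← hgf' ha, ← hgf' hb, hab]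
  · intro b _ hb
    have hb' : f (g b) = b := eq_of_ae_eq_of_negMulLog_ne_zero (h := f ∘ g) hfg hb
    refine ⟨g b, Finset.mem_univ _, ?_, hb'⟩
    rwa [fiber (by rw [hb']), hb']
  · intro a _ ha
    rw [fiber (hgf' ha)]

/-- Derivation of the third (minimum) inequality of Theorem 1. -/
theorem third_inequality_of_theorem_one
    {Ω 𝒮 𝒯 𝒦 𝒲 𝒰 𝒱 𝒵₁ 𝒵₂ 𝒴₁₁ 𝒴₁₂ 𝒴₂₁ 𝒴₂₂ : Type*}
    [MeasurableSpace Ω]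
    [Fintype 𝒮] [Nonempty 𝒮] [MeasurableSpace 𝒮] [MeasurableSingletonClass 𝒮]
    [Fintype 𝒯] [Nonempty 𝒯] [MeasurableSpace 𝒯] [MeasurableSingletonClass 𝒯]
    [Fintype 𝒦] [Nonempty 𝒦] [MeasurableSpace 𝒦] [MeasurableSingletonClass 𝒦]
    [Fintype 𝒲] [Nonempty 𝒲] [MeasurableSpace 𝒲] [MeasurableSingletonClass 𝒲]
    [Fintype 𝒰] [Nonempty 𝒰] [MeasurableSpace 𝒰] [MeasurableSingletonClass 𝒰]
    [Fintype 𝒱] [Nonempty 𝒱] [MeasurableSpace 𝒱] [MeasurableSingletonClass 𝒱]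
    [Fintype 𝒵₁] [Nonempty 𝒵₁] [MeasurableSpace 𝒵₁] [MeasurableSingletonClass 𝒵₁]
    [Fintype 𝒵₂] [Nonempty 𝒵₂] [MeasurableSpace 𝒵₂] [MeasurableSingletonClass 𝒵₂]
    [Fintype 𝒴₁₁] [Nonempty 𝒴₁₁] [MeasurableSpace 𝒴₁₁] [MeasurableSingletonClass 𝒴₁₁]
    [Fintype 𝒴₁₂] [Nonempty 𝒴₁₂] [MeasurableSpace 𝒴₁₂] [MeasurableSingletonClass 𝒴₁₂]
    [Fintype 𝒴₂₁] [Nonempty 𝒴₂₁] [MeasurableSpace 𝒴₂₁] [MeasurableSingletonClass 𝒴₂₁]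
    [Fintype 𝒴₂₂] [Nonempty 𝒴₂₂] [MeasurableSpace 𝒴₂₂] [MeasurableSingletonClass 𝒴₂₂]
    (μ : MeasureTheory.Measure Ω) [MeasureTheory.IsProbabilityMeasure μ]
    (S : Ω → 𝒮)
    (T : Ω → 𝒯)
    (K : Ω → 𝒦)
    (W : Ω → 𝒲)
    (U : Ω → 𝒰)
    (V : Ω → 𝒱)
    (Yh₁ : Ω → 𝒵₁)
    (Yh₂ : Ω → 𝒵₂)
    (Y₁₁ : Ω → 𝒴₁₁)
    (Y₁₂ : Ω → 𝒴₁₂)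
    (Y₂₁ : Ω → 𝒴₂₁)
    (Y₂₂ : Ω → 𝒴₂₂)
    (hS : Measurable S)
    (hT : Measurable T)
    (hK : Measurable K)
    (hW : Measurable W)
    (hU : Measurable U)
    (hV : Measurable V)
    (hYh₁ : Measurable Yh₁)
    (hYh₂ : Measurable Yh₂)
    (hY₁₁ : Measurable Y₁₁)
    (hY₁₂ : Measurable Y₁₂)
    (hY₂₁ : Measurable Y₂₁)
    (hY₂₂ : Measurable Y₂₂)
    (α : 𝒮 → 𝒦) (β : 𝒯 → 𝒦)
    (hKα : ∀ᵐ ω ∂μ, K ω = α (S ω)) (hKβ : ∀ᵐ ω ∂μ, K ω = β (T ω))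
    (ρ₀ ρ₁ ρ₂ r₁ r₂ : ℝ) (hr₁ : 0 ≤ r₁) (hr₂ : 0 ≤ r₂)
    (h1 : cI μ (p2 S T) W K < ρ₀)
    (h2 : cI μ (p2 S U) (p2 T V) W - cI μ S T W < ρ₁ + ρ₂)
    (h3 : cH μ S (p2 K W) ≤ cI μ (p2 S U) (p3 Yh₂ Y₁₁ Y₁₂) (p2 K W) + r₁ - ρ₁)
    (h4 : cH μ T (p2 K W) ≤ cI μ (p2 T V) (p3 Yh₁ Y₂₁ Y₂₂) (p2 K W) + r₂ - ρ₂)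
    (h5 : cH μ S (p2 K W) + H μ K ≤ I μ (p3 S U W) (p3 Yh₂ Y₁₁ Y₁₂) - r₂ - ρ₀ - ρ₁)
    (h6 : cH μ T (p2 K W) + H μ K ≤ I μ (p3 T V W) (p3 Yh₁ Y₂₁ Y₂₂) - r₁ - ρ₀ - ρ₂) :
    H μ (p2 S T) < min (I μ (p2 K W) (p3 Yh₂ Y₁₁ Y₁₂)) (I μ (p2 K W) (p3 Yh₁ Y₂₁ Y₂₂))
      + cI μ (p2 S U) (p3 Yh₂ Y₁₁ Y₁₂) (p2 K W) + cI μ (p2 T V) (p3 Yh₁ Y₂₁ Y₂₂) (p2 K W) - cI μ (p2 S U) (p2 T V) (p2 K W) := by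
  have eSTK : H μ (p2 (p2 S T) K) = H μ (p2 S T) :=
    H_eq_of_ae_eq_comp (fun x => x.1) (fun x => (x, α x.1))
      (ae_of_all _ fun _ => rfl) (hKα.mono fun ω h => by simp [p2, h])
  have eWK : H μ (p2 W K) = H μ (p2 K W) :=
    H_eq_of_ae_eq_comp Prod.swap Prod.swap
      (ae_of_all _ fun _ => rfl) (ae_of_all _ fun _ => rfl)
  have eSTWK : H μ (p2 (p2 S T) (p2 W K)) = H μ (p2 S (p2 T W)) :=
    H_eq_of_ae_eq_comp (fun x => (x.1.1, x.1.2, x.2.1)) (fun x => ((x.1, x.2.1), (x.2.2, α x.1)))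
      (ae_of_all _ fun _ => rfl) (hKα.mono fun ω h => by simp [p2, h])
  have eSUTV : H μ (p2 (p2 S U) (p2 (p2 T V) (p2 K W))) = H μ (p2 (p2 S U) (p2 (p2 T V) W)) :=
    H_eq_of_ae_eq_comp (fun x => (x.1, x.2.1, x.2.2.2)) (fun x => (x.1, x.2.1, α x.1.1, x.2.2))
      (ae_of_all _ fun _ => rfl) (hKα.mono fun ω h => by simp [p2, h])
  have eS : H μ (p2 S (p2 K W)) = H μ (p2 S W) :=
    H_eq_of_ae_eq_comp (fun x => (x.1, x.2.2)) (fun x => (x.1, α x.1, x.2))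
      (ae_of_all _ fun _ => rfl) (hKα.mono fun ω h => by simp [p2, h])
  have eSU : H μ (p2 (p2 S U) (p2 K W)) = H μ (p2 (p2 S U) W) :=
    H_eq_of_ae_eq_comp (fun x => (x.1, x.2.2)) (fun x => (x.1, α x.1.1, x.2))
      (ae_of_all _ fun _ => rfl) (hKα.mono fun ω h => by simp [p2, h])
  have eSUW : H μ (p3 S U W) = H μ (p2 (p2 S U) W) :=
    H_eq_of_ae_eq_comp (fun x => ((x.1, x.2.1), x.2.2)) (fun x => (x.1.1, x.1.2, x.2))
      (ae_of_all _ fun _ => rfl) (ae_of_all _ fun _ => rfl)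
  have eYS : H μ (p2 (p3 Yh₂ Y₁₁ Y₁₂) (p2 K W)) = H μ (p2 (p2 K W) (p3 Yh₂ Y₁₁ Y₁₂)) :=
    H_eq_of_ae_eq_comp Prod.swap Prod.swap
      (ae_of_all _ fun _ => rfl) (ae_of_all _ fun _ => rfl)
  have eSUY : H μ (p2 (p2 S U) (p2 (p3 Yh₂ Y₁₁ Y₁₂) (p2 K W))) =
      H μ (p2 (p3 S U W) (p3 Yh₂ Y₁₁ Y₁₂)) :=
    H_eq_of_ae_eq_comp (fun x => ((x.1.1, x.1.2, x.2.2.2), x.2.1))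
      (fun x => ((x.1.1, x.1.2.1), x.2, α x.1.1, x.1.2.2))
      (ae_of_all _ fun _ => rfl) (hKα.mono fun ω h => by simp [p2, p3, h])
  have eT : H μ (p2 T (p2 K W)) = H μ (p2 T W) :=
    H_eq_of_ae_eq_comp (fun x => (x.1, x.2.2)) (fun x => (x.1, β x.1, x.2))
      (ae_of_all _ fun _ => rfl) (hKβ.mono fun ω h => by simp [p2, h])
  have eTV : H μ (p2 (p2 T V) (p2 K W)) = H μ (p2 (p2 T V) W) :=
    H_eq_of_ae_eq_comp (fun x => (x.1, x.2.2)) (fun x => (x.1, β x.1.1, x.2))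
      (ae_of_all _ fun _ => rfl) (hKβ.mono fun ω h => by simp [p2, h])
  have eTVW : H μ (p3 T V W) = H μ (p2 (p2 T V) W) :=
    H_eq_of_ae_eq_comp (fun x => ((x.1, x.2.1), x.2.2)) (fun x => (x.1.1, x.1.2, x.2))
      (ae_of_all _ fun _ => rfl) (ae_of_all _ fun _ => rfl)
  have eYT : H μ (p2 (p3 Yh₁ Y₂₁ Y₂₂) (p2 K W)) = H μ (p2 (p2 K W) (p3 Yh₁ Y₂₁ Y₂₂)) :=
    H_eq_of_ae_eq_comp Prod.swap Prod.swap
      (ae_of_all _ fun _ => rfl) (ae_of_all _ fun _ => rfl)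
  have eTVY : H μ (p2 (p2 T V) (p2 (p3 Yh₁ Y₂₁ Y₂₂) (p2 K W))) =
      H μ (p2 (p3 T V W) (p3 Yh₁ Y₂₁ Y₂₂)) :=
    H_eq_of_ae_eq_comp (fun x => ((x.1.1, x.1.2, x.2.2.2), x.2.1))
      (fun x => ((x.1.1, x.1.2.1), x.2, β x.1.1, x.1.2.2))
      (ae_of_all _ fun _ => rfl) (hKβ.mono fun ω h => by simp [p2, p3, h])
  simp only [cI, I, cH, eSTK, eWK, eSTWK, eSUTV, eS, eSU, eSUW, eYS, eSUY, eT, eTV, eTVW, eYT,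
    eTVY] at *
  rcases min_choice (H μ (p2 K W) + H μ (p3 Yh₂ Y₁₁ Y₁₂) - H μ (p2 (p2 K W) (p3 Yh₂ Y₁₁ Y₁₂)))
    (H μ (p2 K W) + H μ (p3 Yh₁ Y₂₁ Y₂₂) - H μ (p2 (p2 K W) (p3 Yh₁ Y₂₁ Y₂₂))) with h | h <;>
  · rw [h]
    linarith
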